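/- arXiv:2509.01148 — 2 statements merged into one kernel-verified Lean document; each statement's English description precedes it below -/
import Mathlib

section
/- Let f̄ ≥ 0 and let φ : ℝ^n → ℝ be Lebesgue-measurable with |φ(z)| ≤ f̄ for all z, and let ξ > 0. Then the gradient of the Gaussian smoothing satisfies ‖∇φ_ξ(x)‖ ≤ √(2/π) · f̄/ξ for every x ∈ ℝ^n. -/
open MeasureTheory

/-- The Gaussian kernel `h_ξ(z) = (2πξ²)^{-n/2} exp(-‖z‖²/(2ξ²))` on `ℝⁿ`. -/
noncomputable def gaussKernel (n : ℕ) (ξ : ℝ) (z : EuclideanSpace ℝ (Fin n)) : ℝ :=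
  (2 * Real.pi * ξ ^ 2) ^ (-(n : ℝ) / 2) * Real.exp (-‖z‖ ^ 2 / (2 * ξ ^ 2))

/-- The Gaussian smoothing `φ_ξ(x) = ∫ h_ξ(x - z) φ(z) dz`. -/
noncomputable def gaussSmooth (n : ℕ) (ξ : ℝ) (φ : EuclideanSpace ℝ (Fin n) → ℝ)
    (x : EuclideanSpace ℝ (Fin n)) : ℝ :=
  ∫ z, gaussKernel n ξ (x - z) * φ z

/-- The one-dimensional factor of the Gaussian kernel. -/
noncomputable def gaussFactor (ξ : ℝ) (t : ℝ) : ℝ :=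
  (√(2 * Real.pi * ξ ^ 2))⁻¹ * Real.exp (-(2 * ξ ^ 2)⁻¹ * t ^ 2)

theorem gaussKernel_eq_prod (n : ℕ) {ξ : ℝ} (z : EuclideanSpace ℝ (Fin n)) :
    gaussKernel n ξ z = ∏ i, gaussFactor ξ (z i) := by
  have h0 : 0 ≤ 2 * Real.pi * ξ ^ 2 := by positivity
  simp only [gaussKernel, gaussFactor, Finset.prod_mul_distrib, ← Real.exp_sum,
    ← Finset.mul_sum, Finset.prod_const, Finset.card_univ, Fintype.card_fin]
  congr 1
  · rw [Real.sqrt_eq_rpow, ← Real.rpow_neg h0, ← Real.rpow_mul_natCast h0]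
    congr 1
    ring
  · rw [EuclideanSpace.real_norm_sq_eq]
    congr 1
    ring

theorem gaussKernel_nonneg (n : ℕ) (ξ : ℝ) (z : EuclideanSpace ℝ (Fin n)) :
    0 ≤ gaussKernel n ξ z := by
  unfold gaussKernel
  positivity

theorem continuous_gaussKernel (n : ℕ) (ξ : ℝ) : Continuous (gaussKernel n ξ) := by
  unfold gaussKernel
  fun_prop

theorem integrable_gaussFactor {ξ : ℝ} (hξ : 0 < ξ) : Integrable (gaussFactor ξ) :=
  (integrable_exp_neg_mul_sq (by positivity)).const_mul _

theorem integral_gaussFactor {ξ : ℝ} (hξ : 0 < ξ) : ∫ t, gaussFactor ξ t = 1 := by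
  simp only [gaussFactor]
  rw [integral_const_mul, integral_gaussian, div_inv_eq_mul,
    show Real.pi * (2 * ξ ^ 2) = 2 * Real.pi * ξ ^ 2 by ring]
  exact inv_mul_cancel₀ (by positivity)

theorem integrable_abs_mul_gaussFactor {ξ : ℝ} (hξ : 0 < ξ) :
    Integrable (fun t => |t| * gaussFactor ξ t) := by
  have h := ((integrable_mul_exp_neg_mul_sq (b := (2 * ξ ^ 2)⁻¹) (by positivity)).const_mul
    (√(2 * Real.pi * ξ ^ 2))⁻¹).abs
  refine h.congr (.of_forall fun t => ?_)
  simp only [gaussFactor, abs_mul, Real.abs_exp, abs_inv, abs_of_nonneg (Real.sqrt_nonneg _)]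
  ring

theorem integral_abs_mul_gaussFactor {ξ : ℝ} (hξ : 0 < ξ) :
    ∫ t, |t| * gaussFactor ξ t = √(2 / Real.pi) * ξ := by
  have h1 : ∀ t : ℝ, |t| * gaussFactor ξ t = (fun s => s * gaussFactor ξ s) |t| := fun t => by
    simp [gaussFactor]
  simp_rw [h1]
  rw [integral_comp_abs (f := fun s => s * gaussFactor ξ s)]
  have h2 := integral_rpow_mul_exp_neg_mul_rpow (p := 2) (q := 1) (b := (2 * ξ ^ 2)⁻¹)
    (by norm_num) (by norm_num) (by positivity)
  have h3 : (-(1 + 1) / 2 : ℝ) = -1 := by norm_num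
  have h4 : ((1 + 1) / 2 : ℝ) = 1 := by norm_num
  simp only [Real.rpow_one, Real.rpow_two, h3, h4, Real.Gamma_one, Real.rpow_neg_one,
    inv_inv] at h2
  have h5 : ∀ s : ℝ, s * gaussFactor ξ s =
      (√(2 * Real.pi * ξ ^ 2))⁻¹ * (s * Real.exp (-(2 * ξ ^ 2)⁻¹ * s ^ 2)) := fun s => by
    simp only [gaussFactor]
    ring
  simp_rw [h5]
  rw [integral_const_mul, h2, Real.sqrt_mul (by positivity), Real.sqrt_sq hξ.le,
    Real.sqrt_mul (by norm_num), Real.sqrt_div (by norm_num)]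
  have h6 : √2 ^ 2 = 2 := Real.sq_sqrt (by norm_num)
  have h7 : 0 < √Real.pi := Real.sqrt_pos.2 Real.pi_pos
  field_simp
  rw [h6]

theorem integrable_gaussKernel (n : ℕ) {ξ : ℝ} (hξ : 0 < ξ) : Integrable (gaussKernel n ξ) := by
  rw [← (PiLp.volume_preserving_toLp (Fin n)).integrable_comp_emb
    (MeasurableEquiv.toLp 2 _).measurableEmbedding]
  have h := Integrable.fintype_prod (μ := fun _ : Fin n => (volume : Measure ℝ))
    (f := fun _ => gaussFactor ξ) fun _ => integrable_gaussFactor hξ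
  refine h.congr (.of_forall fun z => ?_)
  simp [gaussKernel_eq_prod]

theorem abs_coord_mul_gaussKernel_eq_prod (n : ℕ) {ξ : ℝ} (i : Fin n)
    (z : EuclideanSpace ℝ (Fin n)) :
    |z i| * gaussKernel n ξ z =
      ∏ j, (if j = i then fun t => |t| * gaussFactor ξ t else gaussFactor ξ) (z j) := by
  rw [gaussKernel_eq_prod, ← Finset.mul_prod_erase _ _ (Finset.mem_univ i),
    ← Finset.mul_prod_erase _ _ (Finset.mem_univ i), if_pos rfl, mul_assoc]
  congr 2
  refine Finset.prod_congr rfl fun j hj => ?_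
  rw [if_neg (Finset.ne_of_mem_erase hj)]

theorem integrable_abs_coord_mul_gaussKernel (n : ℕ) {ξ : ℝ} (hξ : 0 < ξ) (i : Fin n) :
    Integrable (fun z => |z i| * gaussKernel n ξ z) := by
  rw [← (PiLp.volume_preserving_toLp (Fin n)).integrable_comp_emb
    (MeasurableEquiv.toLp 2 _).measurableEmbedding]
  have h := Integrable.fintype_prod (μ := fun _ : Fin n => (volume : Measure ℝ))
    (f := fun j => if j = i then fun t => |t| * gaussFactor ξ t else gaussFactor ξ) fun j => by
      split_ifs
      exacts [integrable_abs_mul_gaussFactor hξ, integrable_gaussFactor hξ]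
  refine h.congr (.of_forall fun z => ?_)
  simp [abs_coord_mul_gaussKernel_eq_prod]

theorem integral_abs_coord_mul_gaussKernel (n : ℕ) {ξ : ℝ} (hξ : 0 < ξ) (i : Fin n) :
    ∫ z, |z i| * gaussKernel n ξ z = √(2 / Real.pi) * ξ := by
  simp_rw [abs_coord_mul_gaussKernel_eq_prod]
  rw [← (PiLp.volume_preserving_toLp (Fin n)).integral_comp
    (MeasurableEquiv.toLp 2 _).measurableEmbedding,
    integral_fintype_prod_volume_eq_prod
    (f := fun j => if j = i then fun t => |t| * gaussFactor ξ t else gaussFactor ξ),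
    ← Finset.mul_prod_erase _ _ (Finset.mem_univ i), if_pos rfl,
    integral_abs_mul_gaussFactor hξ, Finset.prod_eq_one, mul_one]
  intro j hj
  rw [if_neg (Finset.ne_of_mem_erase hj), integral_gaussFactor hξ]

theorem lintegral_abs_inner_mul_gaussKernel (n : ℕ) {ξ : ℝ} (hξ : 0 < ξ)
    (v : EuclideanSpace ℝ (Fin n)) :
    ∫⁻ u, ENNReal.ofReal (|inner ℝ u v| * gaussKernel n ξ u) =
      ENNReal.ofReal (√(2 / Real.pi) * ξ * ‖v‖) := by
  rcases eq_or_ne v 0 with rfl | hv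
  · simp
  have hn : 0 < n := by
    rcases Nat.eq_zero_or_pos n with rfl | h
    · exact absurd (Subsingleton.elim v 0) hv
    · exact h
  let i : Fin n := ⟨0, hn⟩
  have hv' : ‖v‖ ≠ 0 := norm_ne_zero_iff.2 hv
  obtain ⟨b, hb⟩ := Orthonormal.exists_orthonormalBasis_extension_of_card_eq (𝕜 := ℝ)
    (E := EuclideanSpace ℝ (Fin n)) (ι := Fin n) (by simp)
    (v := fun _ => ‖v‖⁻¹ • v) (s := {i}) (by
      rw [orthonormal_subsingleton_iff]
      intro a
      simp [Set.domRestrict, norm_smul, hv'])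
  have hbi : v = ‖v‖ • b i := by
    rw [hb i rfl, smul_smul, mul_inv_cancel₀ hv', one_smul]
  have hcoord : ∀ u, |inner ℝ u v| * gaussKernel n ξ u =
      ‖v‖ * (|b.repr u i| * gaussKernel n ξ (b.repr u)) := fun u => by
    have h1 : gaussKernel n ξ (b.repr u) = gaussKernel n ξ u := by
      simp [gaussKernel]
    have h2 : inner ℝ u v = ‖v‖ * b.repr u i := by
      conv_lhs => rw [hbi]
      rw [inner_smul_right, real_inner_comm, b.repr_apply_apply]
    rw [h1, h2, abs_mul, abs_norm, mul_assoc]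
  simp_rw [hcoord]
  rw [b.measurePreserving_repr.lintegral_comp_emb
    b.repr.toHomeomorph.measurableEmbedding
    (fun u => ENNReal.ofReal (‖v‖ * (|u i| * gaussKernel n ξ u))),
    ← ofReal_integral_eq_lintegral_ofReal
      ((integrable_abs_coord_mul_gaussKernel n hξ i).const_mul _)
      (.of_forall fun u => by have := gaussKernel_nonneg n ξ u; positivity),
    integral_const_mul, integral_abs_coord_mul_gaussKernel n hξ]
  congr 1
  ring

theorem hasDerivAt_gaussKernel_line (n : ℕ) {ξ : ℝ} (hξ : 0 < ξ)
    (w v : EuclideanSpace ℝ (Fin n)) (t : ℝ) :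
    HasDerivAt (fun t : ℝ => gaussKernel n ξ (w + t • v))
      (-(ξ ^ 2)⁻¹ * (inner ℝ (w + t • v) v * gaussKernel n ξ (w + t • v))) t := by
  have h1 : HasDerivAt (fun t : ℝ => w + t • v) v t := by
    simpa using ((hasDerivAt_id t).smul_const v).const_add w
  have h2 := ((h1.norm_sq.neg.div_const (2 * ξ ^ 2)).exp).const_mul
    ((2 * Real.pi * ξ ^ 2) ^ (-(n : ℝ) / 2))
  refine h2.congr_deriv ?_
  simp only [gaussKernel]
  field_simp
  simp [mul_comm, neg_div]

theorem lintegral_enorm_gaussKernel_add_sub_le (n : ℕ) {ξ : ℝ} (hξ : 0 < ξ)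
    (v : EuclideanSpace ℝ (Fin n)) :
    ∫⁻ w, ‖gaussKernel n ξ (w + v) - gaussKernel n ξ w‖ₑ ≤
      ENNReal.ofReal (√(2 / Real.pi) / ξ * ‖v‖) := by
  have hK := continuous_gaussKernel n ξ
  let F : EuclideanSpace ℝ (Fin n) → ENNReal := fun u =>
    ENNReal.ofReal ((ξ ^ 2)⁻¹) * ENNReal.ofReal (|inner ℝ u v| * gaussKernel n ξ u)
  have hF : Continuous fun p : EuclideanSpace ℝ (Fin n) × ℝ =>
      |inner ℝ (p.1 + p.2 • v) v| * gaussKernel n ξ (p.1 + p.2 • v) := by fun_prop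
  have hpt : ∀ w, ‖gaussKernel n ξ (w + v) - gaussKernel n ξ w‖ₑ ≤
      ∫⁻ t in Set.Ioc (0 : ℝ) 1, F (w + t • v) := fun w => by
    have h := intervalIntegral.integral_eq_sub_of_hasDerivAt (a := 0) (b := 1)
      (fun t _ => hasDerivAt_gaussKernel_line n hξ w v t)
      (Continuous.intervalIntegrable (by fun_prop) _ _)
    simp only [one_smul, zero_smul, add_zero] at h
    rw [← h, intervalIntegral.integral_of_le zero_le_one]
    refine (enorm_integral_le_lintegral_enorm _).trans (lintegral_mono fun t => le_of_eq ?_)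
    simp only [F]
    rw [← ENNReal.ofReal_mul (by positivity), Real.enorm_eq_ofReal_abs, abs_mul, abs_neg, abs_mul,
      abs_of_nonneg (gaussKernel_nonneg n ξ _), abs_of_nonneg (by positivity : 0 ≤ (ξ ^ 2)⁻¹)]
  calc ∫⁻ w, ‖gaussKernel n ξ (w + v) - gaussKernel n ξ w‖ₑ
      ≤ ∫⁻ w, ∫⁻ t in Set.Ioc (0 : ℝ) 1, F (w + t • v) := lintegral_mono hpt
    _ = ∫⁻ t in Set.Ioc (0 : ℝ) 1, ∫⁻ w, F (w + t • v) :=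
        lintegral_lintegral_swap (hF.measurable.ennreal_ofReal.const_mul _).aemeasurable
    _ = ∫⁻ _ in Set.Ioc (0 : ℝ) 1, ∫⁻ w, F w := by
        simp_rw [lintegral_add_right_eq_self]
    _ = ENNReal.ofReal (√(2 / Real.pi) / ξ * ‖v‖) := by
        rw [setLIntegral_const, Real.volume_Ioc, sub_zero, ENNReal.ofReal_one, mul_one,
          lintegral_const_mul' _ _ ENNReal.ofReal_ne_top, lintegral_abs_inner_mul_gaussKernel n hξ,
          ← ENNReal.ofReal_mul (by positivity)]
        congr 1
        field_simp

theorem abs_gaussSmooth_sub_le (n : ℕ) {fbar ξ : ℝ} (hfbar : 0 ≤ fbar) (hξ : 0 < ξ)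
    {φ : EuclideanSpace ℝ (Fin n) → ℝ} (hmeas : Measurable φ) (hbdd : ∀ z, |φ z| ≤ fbar)
    (x y : EuclideanSpace ℝ (Fin n)) :
    |gaussSmooth n ξ φ y - gaussSmooth n ξ φ x| ≤ √(2 / Real.pi) * fbar / ξ * ‖y - x‖ := by
  have hint : ∀ x, Integrable fun z => gaussKernel n ξ (x - z) * φ z := fun x =>
    ((integrable_gaussKernel n hξ).comp_sub_left x).mul_bdd hmeas.aestronglyMeasurable
      (.of_forall hbdd)
  rw [← ENNReal.ofReal_le_ofReal_iff (by positivity), ← Real.enorm_eq_ofReal_abs]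
  unfold gaussSmooth
  rw [← integral_sub (hint y) (hint x)]
  let G : EuclideanSpace ℝ (Fin n) → ENNReal := fun w =>
    ‖gaussKernel n ξ (w + (y - x)) - gaussKernel n ξ w‖ₑ
  calc _ ≤ ∫⁻ z, ‖gaussKernel n ξ (y - z) * φ z - gaussKernel n ξ (x - z) * φ z‖ₑ :=
        enorm_integral_le_lintegral_enorm _
    _ ≤ ∫⁻ z, ENNReal.ofReal fbar * G (x - z) := lintegral_mono fun z => by
        simp only [G]
        rw [← sub_mul, enorm_mul, mul_comm, show x - z + (y - x) = y - z by abel,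
          Real.enorm_eq_ofReal_abs (φ z)]
        gcongr
        exact hbdd z
    _ = ENNReal.ofReal fbar * ∫⁻ w, G w := by
        rw [lintegral_const_mul' _ _ ENNReal.ofReal_ne_top, lintegral_sub_left_eq_self]
    _ ≤ ENNReal.ofReal fbar * ENNReal.ofReal (√(2 / Real.pi) / ξ * ‖y - x‖) := by
        gcongr
        exact lintegral_enorm_gaussKernel_add_sub_le n hξ (y - x)
    _ = _ := by
        rw [← ENNReal.ofReal_mul hfbar]
        congr 1
        ring

/-- If `|φ| ≤ f̄` and `ξ > 0`, then `‖∇φ_ξ(x)‖ ≤ √(2/π) f̄ / ξ` for all `x`. -/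
theorem stmt_5 (n : ℕ) (hn : 1 ≤ n) (fbar : ℝ) (hfbar : 0 ≤ fbar)
    (φ : EuclideanSpace ℝ (Fin n) → ℝ) (hmeas : Measurable φ)
    (hbdd : ∀ z, |φ z| ≤ fbar) (ξ : ℝ) (hξ : 0 < ξ) :
    ∀ x, ‖gradient (gaussSmooth n ξ φ) x‖ ≤ Real.sqrt (2 / Real.pi) * fbar / ξ := by
  intro x
  rw [gradient, LinearIsometryEquiv.norm_map]
  exact norm_fderiv_le_of_lip' ℝ (by positivity)
    (.of_forall fun y => abs_gaussSmooth_sub_le n hfbar hξ hmeas hbdd x y)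
end

section
/- Let n ≥ 1, ξ > 0, f̄ ≥ 0, L ≥ 0, ρ ≥ 0 and V ≥ 0. Let f₁, f₂ : ℝ^n → ℝ be Lebesgue-measurable with |f₁(z)| ≤ f̄ and |f₂(z)| ≤ f̄ for all z, let S ⊆ ℝ^n be a measurable set with Lebesgue measure λ(S) ≤ V, and assume |f₁(z) − f₂(z)| ≤ L ρ for every z ∉ S. Then for every x ∈ ℝ^n, ‖∫_{ℝ^n} ∇_x h_ξ(x − z) (f₁(z) − f₂(z)) dz‖ ≤ √2 · (Γ((n+1)/2)/Γ(n/2)) · Lρ/ξ + 2 f̄ V e^{−1/2} / ((2π)^{n/2} ξ^{n+1}). -/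
open MeasureTheory

lemma pow_sub_one_smul_mul_exp {n : ℕ} (hn : 1 ≤ n) (b y : ℝ) :
    y ^ (n - 1) • (y * Real.exp (-b * y ^ 2)) = y ^ (n : ℝ) * Real.exp (-b * y ^ (2 : ℝ)) := by
  obtain ⟨m, rfl⟩ := Nat.exists_eq_add_of_le' hn
  rw [Real.rpow_natCast, Real.rpow_two, smul_eq_mul, Nat.add_sub_cancel, pow_succ]
  ring

/-- The function `‖z‖ exp(-b‖z‖²)` is integrable on `ℝⁿ`. -/
lemma integrable_norm_mul_exp {n : ℕ} (hn : 1 ≤ n) {b : ℝ} (hb : 0 < b) :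
    Integrable (fun z : EuclideanSpace ℝ (Fin n) ↦ ‖z‖ * Real.exp (-b * ‖z‖ ^ 2)) := by
  have : Nonempty (Fin n) := ⟨⟨0, hn⟩⟩
  rw [integrable_fun_norm_addHaar volume (f := fun y ↦ y * Real.exp (-b * y ^ 2)),
    finrank_euclideanSpace_fin]
  have hn0 : (0 : ℝ) ≤ n := n.cast_nonneg
  exact (integrableOn_rpow_mul_exp_neg_mul_rpow (by linarith) two_pos hb).congr_fun
    (fun y _ ↦ (pow_sub_one_smul_mul_exp hn b y).symm) measurableSet_Ioi

/-- The first absolute moment of an unnormalised Gaussian on `ℝⁿ`. -/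
lemma integral_norm_mul_exp {n : ℕ} (hn : 1 ≤ n) {b : ℝ} (hb : 0 < b) :
    ∫ z : EuclideanSpace ℝ (Fin n), ‖z‖ * Real.exp (-b * ‖z‖ ^ 2) =
      Real.pi ^ ((n : ℝ) / 2) * b ^ (-((n : ℝ) + 1) / 2) *
        (Real.Gamma (((n : ℝ) + 1) / 2) / Real.Gamma ((n : ℝ) / 2)) := by
  have : Nonempty (Fin n) := ⟨⟨0, hn⟩⟩
  have hn0 : (0 : ℝ) < n := by exact_mod_cast hn
  have hΓ : 0 < Real.Gamma ((n : ℝ) / 2) := Real.Gamma_pos_of_pos (by positivity)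
  have hvol : volume.real (Metric.ball (0 : EuclideanSpace ℝ (Fin n)) 1) =
      Real.pi ^ ((n : ℝ) / 2) / ((n : ℝ) / 2 * Real.Gamma ((n : ℝ) / 2)) := by
    rw [measureReal_def, EuclideanSpace.volume_ball, Fintype.card_fin,
      Real.Gamma_add_one (by positivity), ENNReal.ofReal_one, one_pow, one_mul,
      ENNReal.toReal_ofReal (by positivity), Real.sqrt_eq_rpow, ← Real.rpow_mul_natCast
      Real.pi_pos.le, one_div_mul_eq_div]
  rw [integral_fun_norm_addHaar volume (fun y ↦ y * Real.exp (-b * y ^ 2)),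
    finrank_euclideanSpace_fin,
    setIntegral_congr_fun measurableSet_Ioi (fun y _ ↦ pow_sub_one_smul_mul_exp hn b y),
    integral_rpow_mul_exp_neg_mul_rpow two_pos (by linarith) hb, hvol, nsmul_eq_mul, smul_eq_mul]
  field_simp

lemma gaussKernel_mul_norm_eq (n : ℕ) (ξ : ℝ) (z : EuclideanSpace ℝ (Fin n)) :
    (ξ ^ 2)⁻¹ * gaussKernel n ξ z * ‖z‖ =
      ((ξ ^ 2)⁻¹ * (2 * Real.pi * ξ ^ 2) ^ (-(n : ℝ) / 2)) *
        (‖z‖ * Real.exp (-(2 * ξ ^ 2)⁻¹ * ‖z‖ ^ 2)) := by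
  rw [gaussKernel, show -‖z‖ ^ 2 / (2 * ξ ^ 2) = -(2 * ξ ^ 2)⁻¹ * ‖z‖ ^ 2 by ring]
  ring

/-- The gradient of the Gaussian kernel is integrable in norm. -/
lemma integrable_gaussKernel_mul_norm {n : ℕ} (hn : 1 ≤ n) {ξ : ℝ} (hξ : 0 < ξ) :
    Integrable (fun z ↦ (ξ ^ 2)⁻¹ * gaussKernel n ξ z * ‖z‖) := by
  simp_rw [gaussKernel_mul_norm_eq]
  exact (integrable_norm_mul_exp hn (by positivity)).const_mul _

/-- The `L¹` norm of the gradient of the Gaussian kernel. -/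
lemma integral_gaussKernel_mul_norm {n : ℕ} (hn : 1 ≤ n) {ξ : ℝ} (hξ : 0 < ξ) :
    ∫ z, (ξ ^ 2)⁻¹ * gaussKernel n ξ z * ‖z‖ =
      Real.sqrt 2 * (Real.Gamma (((n : ℝ) + 1) / 2) / Real.Gamma ((n : ℝ) / 2)) / ξ := by
  have hpow : (2 * ξ ^ 2)⁻¹ ^ (-((n : ℝ) + 1) / 2) =
      (2 * ξ ^ 2) ^ ((n : ℝ) / 2) * (Real.sqrt 2 * ξ) := by
    rw [Real.inv_rpow (by positivity), ← Real.rpow_neg (by positivity),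
      show -(-((n : ℝ) + 1) / 2) = (n : ℝ) / 2 + 1 / 2 by ring,
      Real.rpow_add (by positivity), ← Real.sqrt_eq_rpow, Real.sqrt_mul two_pos.le,
      Real.sqrt_sq hξ.le]
  have hnorm : (2 * Real.pi * ξ ^ 2) ^ (-(n : ℝ) / 2) =
      (Real.pi ^ ((n : ℝ) / 2) * (2 * ξ ^ 2) ^ ((n : ℝ) / 2))⁻¹ := by
    rw [← Real.mul_rpow (by positivity) (by positivity), neg_div, Real.rpow_neg (by positivity)]
    congr 2
    ring
  simp_rw [gaussKernel_mul_norm_eq]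
  rw [integral_const_mul, integral_norm_mul_exp hn (by positivity), hpow, hnorm]
  have h₁ : 0 < Real.pi ^ ((n : ℝ) / 2) := by positivity
  have h₂ : 0 < (2 * ξ ^ 2) ^ ((n : ℝ) / 2) := by positivity
  field_simp

/-- The sup norm of the gradient of the Gaussian kernel. -/
lemma gaussKernel_mul_norm_le {n : ℕ} {ξ : ℝ} (hξ : 0 < ξ) (z : EuclideanSpace ℝ (Fin n)) :
    (ξ ^ 2)⁻¹ * gaussKernel n ξ z * ‖z‖ ≤
      Real.exp (-(1 / 2)) / ((2 * Real.pi) ^ ((n : ℝ) / 2) * ξ ^ (n + 1)) := by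
  have hnorm : (2 * Real.pi * ξ ^ 2) ^ (-(n : ℝ) / 2) =
      ((2 * Real.pi) ^ ((n : ℝ) / 2) * ξ ^ n)⁻¹ := by
    rw [neg_div, Real.rpow_neg (by positivity), Real.mul_rpow (by positivity) (by positivity),
      ← Real.rpow_natCast_mul hξ.le, ← Real.rpow_natCast ξ n]
    congr 3
    push_cast
    ring
  have hexp : ‖z‖ / ξ * Real.exp (-‖z‖ ^ 2 / (2 * ξ ^ 2)) ≤ Real.exp (-(1 / 2)) := by
    have h := Real.add_one_le_exp (((‖z‖ / ξ) ^ 2 - 1) / 2)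
    calc ‖z‖ / ξ * Real.exp (-‖z‖ ^ 2 / (2 * ξ ^ 2))
        ≤ Real.exp (((‖z‖ / ξ) ^ 2 - 1) / 2) * Real.exp (-‖z‖ ^ 2 / (2 * ξ ^ 2)) := by
          gcongr
          nlinarith [sq_nonneg (‖z‖ / ξ - 1)]
      _ = Real.exp (-(1 / 2)) := by
          rw [← Real.exp_add]
          congr 1
          field_simp
          ring
  calc (ξ ^ 2)⁻¹ * gaussKernel n ξ z * ‖z‖
      = ((2 * Real.pi) ^ ((n : ℝ) / 2) * ξ ^ (n + 1))⁻¹ *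
          (‖z‖ / ξ * Real.exp (-‖z‖ ^ 2 / (2 * ξ ^ 2))) := by
        rw [gaussKernel, hnorm]
        field_simp
        ring
    _ ≤ ((2 * Real.pi) ^ ((n : ℝ) / 2) * ξ ^ (n + 1))⁻¹ * Real.exp (-(1 / 2)) := by gcongr
    _ = _ := (div_eq_inv_mul _ _).symm

/-- If `|f₁|, |f₂| ≤ f̄`, `|f₁ - f₂| ≤ Lρ` off a measurable set `S` of
Lebesgue measure at most `V`, then for every `x`,
`‖∫ ∇ₓh_ξ(x-z)(f₁(z) - f₂(z)) dz‖ ≤ √2 (Γ((n+1)/2)/Γ(n/2)) Lρ/ξ + 2 f̄ V e^{-1/2}/((2π)^{n/2} ξ^{n+1})`,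
where `∇ₓh_ξ(x-z) = -((x-z)/ξ²) h_ξ(x-z)`. -/
theorem stmt_12 (n : ℕ) (hn : 1 ≤ n) (ξ : ℝ) (hξ : 0 < ξ)
    (fbar L ρ V : ℝ) (hfbar : 0 ≤ fbar) (hL : 0 ≤ L) (hρ : 0 ≤ ρ) (hV : 0 ≤ V)
    (f₁ f₂ : EuclideanSpace ℝ (Fin n) → ℝ)
    (hmeas₁ : Measurable f₁) (hmeas₂ : Measurable f₂)
    (hbdd₁ : ∀ z, |f₁ z| ≤ fbar) (hbdd₂ : ∀ z, |f₂ z| ≤ fbar)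
    (S : Set (EuclideanSpace ℝ (Fin n))) (hS : MeasurableSet S)
    (hSV : volume S ≤ ENNReal.ofReal V)
    (hclose : ∀ z ∉ S, |f₁ z - f₂ z| ≤ L * ρ) :
    ∀ x : EuclideanSpace ℝ (Fin n),
      ‖∫ z, ((-(ξ ^ 2)⁻¹ * gaussKernel n ξ (x - z)) * (f₁ z - f₂ z)) • (x - z)‖
        ≤ Real.sqrt 2 * (Real.Gamma (((n : ℝ) + 1) / 2) / Real.Gamma ((n : ℝ) / 2))
              * L * ρ / ξ
          + 2 * fbar * V * Real.exp (-(1 / 2))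
              / ((2 * Real.pi) ^ ((n : ℝ) / 2) * ξ ^ (n + 1)) := by
  intro x
  set M := Real.exp (-(1 / 2)) / ((2 * Real.pi) ^ ((n : ℝ) / 2) * ξ ^ (n + 1)) with hM
  have hM0 : 0 ≤ M := by positivity
  let K : EuclideanSpace ℝ (Fin n) → ℝ := fun z ↦ (ξ ^ 2)⁻¹ * gaussKernel n ξ z * ‖z‖
  have hh0 (z : EuclideanSpace ℝ (Fin n)) : 0 ≤ (ξ ^ 2)⁻¹ * gaussKernel n ξ z := by
    unfold gaussKernel; positivity
  have hK0 (z : EuclideanSpace ℝ (Fin n)) : 0 ≤ K z := mul_nonneg (hh0 z) (norm_nonneg z)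
  have hint₁ : Integrable (fun z ↦ L * ρ * K (x - z)) :=
    ((integrable_gaussKernel_mul_norm hn hξ).comp_sub_left x).const_mul _
  have hSfin : volume S ≠ ⊤ := ne_top_of_le_ne_top ENNReal.ofReal_ne_top hSV
  have hint₂ : Integrable (S.indicator fun _ ↦ 2 * fbar * M) :=
    (integrable_indicator_iff hS).2 (integrableOn_const hSfin)
  have hbound (z : EuclideanSpace ℝ (Fin n)) :
      ‖((-(ξ ^ 2)⁻¹ * gaussKernel n ξ (x - z)) * (f₁ z - f₂ z)) • (x - z)‖
        ≤ L * ρ * K (x - z) + S.indicator (fun _ ↦ 2 * fbar * M) z := by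
    have hnorm : ‖((-(ξ ^ 2)⁻¹ * gaussKernel n ξ (x - z)) * (f₁ z - f₂ z)) • (x - z)‖ =
        |f₁ z - f₂ z| * K (x - z) := by
      rw [norm_smul, norm_mul, neg_mul, norm_neg, Real.norm_of_nonneg (hh0 _), Real.norm_eq_abs]
      ring
    rw [hnorm]
    by_cases hz : z ∈ S
    · have hf : |f₁ z - f₂ z| ≤ 2 * fbar :=
        (abs_sub _ _).trans (by linarith [hbdd₁ z, hbdd₂ z])
      have h₁ : |f₁ z - f₂ z| * K (x - z) ≤ 2 * fbar * M :=
        mul_le_mul hf (gaussKernel_mul_norm_le hξ _) (hK0 _) (by positivity)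
      have h₂ : 0 ≤ L * ρ * K (x - z) := mul_nonneg (mul_nonneg hL hρ) (hK0 _)
      rw [Set.indicator_of_mem hz]
      linarith
    · rw [Set.indicator_of_notMem hz, add_zero]
      exact mul_le_mul_of_nonneg_right (hclose z hz) (hK0 _)
  have hvol : volume.real S ≤ V := ENNReal.toReal_le_of_le_ofReal hV hSV
  calc _ ≤ ∫ z, (L * ρ * K (x - z) + S.indicator (fun _ ↦ 2 * fbar * M) z) :=
        norm_integral_le_of_norm_le (hint₁.add hint₂) (.of_forall hbound)
    _ = L * ρ * (∫ z, K z) + volume.real S * (2 * fbar * M) := by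
        rw [integral_add hint₁ hint₂, integral_const_mul, integral_sub_left_eq_self K volume x,
          integral_indicator_const _ hS, smul_eq_mul]
    _ ≤ L * ρ * (∫ z, K z) + V * (2 * fbar * M) := by gcongr
    _ = _ := by
        rw [integral_gaussKernel_mul_norm hn hξ, hM]
        ring
end
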